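/- Let m₁ > 1/2 and m₂ > 1/2. There exists a constant C_{m₁,m₂} > 0, independent of σ, such that for all σ ≥ 0 and all u, v ∈ G^{m₁}_σ ∩ G^{m₂}_σ, the pointwise product uv lies in G^{m₁}_σ and ‖uv‖_{G^{m₁}_σ} ≤ C_{m₁,m₂} ( ‖u‖_{G^{m₁}_σ} ‖v‖_{G^{m₂}_σ} + ‖u‖_{G^{m₂}_σ} ‖v‖_{G^{m₁}_σ} ). -/

import Mathlib

open MeasureTheory

noncomputable def fHat {E : Type*} [NormedAddCommGroup E] [NormedSpace ℂ E]
    (u : ℝ → E) (k : ℝ) : E :=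
  (Real.sqrt (2 * Real.pi))⁻¹ • ∫ x : ℝ, Complex.exp (-(Complex.I * k * x)) • u x

noncomputable def gevreyWeight (m σ k : ℝ) : ℝ :=
  Real.exp (2 * σ * (1 + |k|)) * (1 + k ^ 2) ^ m

def MemGevrey {E : Type*} [NormedAddCommGroup E] [NormedSpace ℂ E]
    (m σ : ℝ) (u : ℝ → E) : Prop :=
  Integrable u ∧ Integrable (fun k => gevreyWeight m σ k * ‖fHat u k‖ ^ 2)

noncomputable def gevreyNorm {E : Type*} [NormedAddCommGroup E] [NormedSpace ℂ E]
    (m σ : ℝ) (u : ℝ → E) : ℝ :=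
  Real.sqrt (∫ k : ℝ, gevreyWeight m σ k * ‖fHat u k‖ ^ 2)

def GevreyContOn {E : Type*} [NormedAddCommGroup E] [NormedSpace ℂ E]
    (m σ : ℝ) (u : ℝ → ℝ → E) (s : Set ℝ) : Prop :=
  (∀ t ∈ s, MemGevrey m σ (u t)) ∧
  ∀ t ∈ s, Filter.Tendsto (fun t' => gevreyNorm m σ (fun x => u t' x - u t x))
      (nhdsWithin t s) (nhds 0)

def GevreyC1On {E : Type*} [NormedAddCommGroup E] [NormedSpace ℂ E]
    (m σ : ℝ) (u : ℝ → ℝ → E) (s : Set ℝ) : Prop :=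
  ∃ v : ℝ → ℝ → E,
    (∀ t ∈ s, Filter.Tendsto
      (fun t' => gevreyNorm m σ (fun x => (t' - t)⁻¹ • (u t' x - u t x) - v t x))
      (nhdsWithin t (s \ {t})) (nhds 0)) ∧
    GevreyContOn m σ v s

open scoped FourierTransform ENNReal SchwartzMap

theorem integral_fourier_mul_eq_of_integrable {f g : ℝ → ℂ} (hf : Integrable f)
    (hg : Integrable g) : ∫ x, 𝓕 f x * g x = ∫ x, f x * 𝓕 g x := by
  simpa using! VectorFourier.integral_fourierIntegral_smul_eq_flip (L := innerₗ ℝ)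
    Real.continuous_fourierChar continuous_inner hf hg

theorem integral_fourierInv_mul_eq_of_integrable {f g : ℝ → ℂ} (hf : Integrable f)
    (hg : Integrable g) : ∫ x, 𝓕⁻ f x * g x = ∫ x, f x * 𝓕⁻ g x := by
  have h := integral_fourier_mul_eq_of_integrable hf hg.comp_neg
  rw [← integral_neg_eq_self] at h
  simp_rw [← Real.fourierInv_eq_fourier_comp_neg, ← Real.fourierInv_eq_fourier_neg, neg_neg] at h
  exact h

theorem continuous_fourier_of_integrable {f : ℝ → ℂ} (hf : Integrable f) : Continuous (𝓕 f) :=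
  VectorFourier.fourierIntegral_continuous Real.continuous_fourierChar continuous_inner hf

theorem norm_fourierInv_le (f : ℝ → ℂ) (x : ℝ) : ‖𝓕⁻ f x‖ ≤ ∫ k, ‖f k‖ := by
  rw [Real.fourierInv_eq]
  refine (norm_integral_le_integral_norm _).trans_eq ?_
  simp_rw [Circle.norm_smul]

theorem continuous_fourierInv_of_integrable {f : ℝ → ℂ} (hf : Integrable f) :
    Continuous (𝓕⁻ f) := by
  have : 𝓕⁻ f = fun x => 𝓕 f (-x) := funext fun x => Real.fourierInv_eq_fourier_neg f x
  rw [this]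
  exact (continuous_fourier_of_integrable hf).comp continuous_neg

/-- Fourier inversion almost everywhere, without continuity of the function. -/
theorem fourierInv_fourier_ae_eq {u : ℝ → ℂ} (hu : Integrable u) (hu' : Integrable (𝓕 u)) :
    𝓕⁻ (𝓕 u) =ᵐ[volume] u := by
  have hc := continuous_fourierInv_of_integrable hu'
  refine ae_eq_of_integral_contDiff_smul_eq hc.locallyIntegrable hu.locallyIntegrable
    fun g hg hgs => ?_
  have hgs' : HasCompactSupport (fun x => (g x : ℂ)) := hgs.comp_left Complex.ofReal_zero
  let G : 𝓢(ℝ, ℂ) := hgs'.toSchwartzMap (Complex.ofRealCLM.contDiff.comp hg)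
  let φ : 𝓢(ℝ, ℂ) := 𝓕⁻ G
  have hφ : 𝓕 (φ : ℝ → ℂ) = G := by
    rw [← SchwartzMap.fourier_coe, FourierTransform.fourier_fourierInv_eq]
  have hφ' : 𝓕⁻ (G : ℝ → ℂ) = φ := by
    rw [← SchwartzMap.fourierInv_coe]
  have h₁ := integral_fourier_mul_eq_of_integrable hu φ.integrable
  have h₂ := integral_fourierInv_mul_eq_of_integrable hu' G.integrable
  rw [hφ] at h₁
  rw [hφ', h₁] at h₂
  have hG (x : ℝ) : G x = g x := rfl
  simp_rw [hG] at h₂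
  simpa [mul_comm] using h₂

theorem fourier_mul_eq_integral {u v : ℝ → ℂ} (hu : Integrable u) (hu' : Integrable (𝓕 u))
    (hv : Integrable v) (w : ℝ) :
    𝓕 (fun x => u x * v x) w = ∫ ξ, 𝓕 u ξ * 𝓕 v (w - ξ) := by
  have hv' : Integrable (fun x => Real.fourierChar (-(x * w)) • v x) := by
    simpa [mul_comm] using! (Real.fourierIntegral_convergent_iff (f := v) (μ := volume) w).2 hv
  have h := integral_fourierInv_mul_eq_of_integrable hu' hv'
  have e₁ : 𝓕 (fun x => u x * v x) w =
      ∫ x, 𝓕⁻ (𝓕 u) x * (Real.fourierChar (-(x * w)) • v x) := by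
    rw [Real.fourier_real_eq]
    refine integral_congr_ae ?_
    filter_upwards [fourierInv_fourier_ae_eq hu hu'] with x hx
    rw [hx, mul_smul_comm]
  have e₂ (ξ : ℝ) : 𝓕⁻ (fun x => Real.fourierChar (-(x * w)) • v x) ξ = 𝓕 v (w - ξ) := by
    rw [Real.fourierInv_eq_fourier_neg, Real.fourier_real_eq, Real.fourier_real_eq]
    congr 1
    ext x
    rw [smul_smul, ← AddChar.map_add_eq_mul]
    congr 2
    ring
  simp_rw [e₁, h, e₂]

theorem integrable_mul_of_integrable_fourier {u v : ℝ → ℂ} (hu : Integrable u)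
    (hu' : Integrable (𝓕 u)) (hv : Integrable v) : Integrable (fun x => u x * v x) := by
  refine hv.bdd_mul (c := ∫ k, ‖𝓕 u k‖) hu.aestronglyMeasurable ?_
  filter_upwards [fourierInv_fourier_ae_eq hu hu'] with x hx
  rw [← hx]
  exact norm_fourierInv_le _ _

theorem fHat_eq_fourier (u : ℝ → ℂ) (k : ℝ) :
    fHat u k = (Real.sqrt (2 * Real.pi))⁻¹ • 𝓕 u (k / (2 * Real.pi)) := by
  rw [fHat, Real.fourier_real_eq_integral_exp_smul]
  congr 2
  ext x
  congr 2
  push_cast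
  field_simp

theorem continuous_fHat {u : ℝ → ℂ} (hu : Integrable u) : Continuous (fHat u) := by
  have : fHat u = fun k => (Real.sqrt (2 * Real.pi))⁻¹ • 𝓕 u (k / (2 * Real.pi)) :=
    funext (fHat_eq_fourier u)
  rw [this]
  have := continuous_fourier_of_integrable hu
  fun_prop

theorem integrable_fourier_of_integrable_fHat {u : ℝ → ℂ} (hu : Integrable (fHat u)) :
    Integrable (𝓕 u) := by
  have h := (hu.comp_mul_left' (R := 2 * Real.pi) (by positivity)).smul (Real.sqrt (2 * Real.pi))
  refine h.congr (Filter.Eventually.of_forall fun k => ?_)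
  have : Real.sqrt (2 * Real.pi) ≠ 0 := by positivity
  simp only [Pi.smul_apply, fHat_eq_fourier, smul_smul]
  rw [mul_inv_cancel₀ this, one_smul, mul_div_cancel_left₀ _ (by positivity)]

theorem fHat_mul_eq_integral {u v : ℝ → ℂ} (hu : Integrable u) (hu' : Integrable (fHat u))
    (hv : Integrable v) (k : ℝ) :
    fHat (fun x => u x * v x) k =
      (Real.sqrt (2 * Real.pi))⁻¹ • ∫ l, fHat u l * fHat v (k - l) := by
  have h := fourier_mul_eq_integral hu (integrable_fourier_of_integrable_fHat hu') hv
    (k / (2 * Real.pi))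
  have hs := Measure.integral_comp_div
    (fun ξ => 𝓕 u ξ * 𝓕 v (k / (2 * Real.pi) - ξ)) (2 * Real.pi)
  have hpi : 0 < 2 * Real.pi := by positivity
  rw [fHat_eq_fourier, h]
  simp_rw [fHat_eq_fourier, smul_mul_smul_comm, sub_div]
  rw [integral_smul, hs, smul_smul (_ * _), abs_of_pos hpi, ← mul_inv,
    Real.mul_self_sqrt hpi.le, inv_mul_cancel₀ hpi.ne', one_smul]

theorem enorm_fHat_mul_le {u v : ℝ → ℂ} (hu : Integrable u) (hu' : Integrable (fHat u))
    (hv : Integrable v) (k : ℝ) :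
    ‖fHat (fun x => u x * v x) k‖ₑ ≤ ∫⁻ l, ‖fHat u (k - l)‖ₑ * ‖fHat v l‖ₑ := by
  have hc : ‖(Real.sqrt (2 * Real.pi))⁻¹‖ₑ ≤ 1 := by
    rw [← enorm_one (G := ℝ), enorm_le_iff_norm_le, norm_inv, norm_one,
      Real.norm_of_nonneg (Real.sqrt_nonneg _)]
    refine inv_le_one_of_one_le₀ (Real.one_le_sqrt.2 ?_)
    linarith [Real.pi_gt_three]
  rw [fHat_mul_eq_integral hu hu' hv, enorm_smul]
  calc _ ≤ 1 * ∫⁻ l, ‖fHat u l * fHat v (k - l)‖ₑ :=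
        mul_le_mul' hc (enorm_integral_le_lintegral_enorm _)
    _ = ∫⁻ l, ‖fHat u l‖ₑ * ‖fHat v (k - l)‖ₑ := by simp_rw [one_mul, enorm_mul]
    _ = _ := by
      rw [← lintegral_sub_left_eq_self _ k]
      simp

theorem sq_lintegral_mul_le {f g : ℝ → ℝ≥0∞} (hf : Measurable f) (hg : Measurable g) :
    (∫⁻ x, f x * g x) ^ 2 ≤ (∫⁻ x, f x ^ 2) * ∫⁻ x, g x ^ 2 := by
  have h := ENNReal.lintegral_mul_le_Lp_mul_Lq volume Real.HolderConjugate.two_two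
    hf.aemeasurable hg.aemeasurable
  simp only [Pi.mul_apply, ENNReal.rpow_two] at h
  refine (pow_le_pow_left' h 2).trans_eq ?_
  rw [mul_pow, ← ENNReal.rpow_two, ← ENNReal.rpow_two, ← ENNReal.rpow_mul, ← ENNReal.rpow_mul]
  norm_num

theorem sq_lintegral_mul_le_of_weight {f g : ℝ → ℝ≥0∞} (hf : Measurable f) (hg : Measurable g) :
    (∫⁻ x, f x * g x) ^ 2 ≤ (∫⁻ x, f x ^ 2 * g x) * ∫⁻ x, g x := by
  have hs (x : ℝ) : (g x ^ (1 / 2 : ℝ)) ^ 2 = g x := by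
    rw [← ENNReal.rpow_two, ← ENNReal.rpow_mul]
    norm_num
  have h := sq_lintegral_mul_le (hf.mul (hg.pow_const (1 / 2 : ℝ))) (hg.pow_const (1 / 2 : ℝ))
  simpa only [Pi.mul_apply, mul_assoc, mul_pow, hs, ← sq] using h

/-- Young's convolution inequality `L² * L¹ → L²`. -/
theorem lintegral_sq_conv_le {f g : ℝ → ℝ≥0∞} (hf : Measurable f) (hg : Measurable g) :
    ∫⁻ k, (∫⁻ l, f (k - l) * g l) ^ 2 ≤ (∫⁻ k, f k ^ 2) * (∫⁻ l, g l) ^ 2 := by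
  calc ∫⁻ k, (∫⁻ l, f (k - l) * g l) ^ 2
      ≤ ∫⁻ k, (∫⁻ l, f (k - l) ^ 2 * g l) * ∫⁻ l, g l :=
        lintegral_mono fun k => sq_lintegral_mul_le_of_weight (by fun_prop) hg
    _ = (∫⁻ l, ∫⁻ k, f (k - l) ^ 2 * g l) * ∫⁻ l, g l := by
        rw [lintegral_mul_const _ (by fun_prop), lintegral_lintegral_swap (by fun_prop)]
    _ = _ := by
        have (l : ℝ) : ∫⁻ k, f (k - l) ^ 2 * g l = (∫⁻ k, f k ^ 2) * g l := by
          rw [lintegral_mul_const _ (by fun_prop),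
            lintegral_sub_right_eq_self (fun k => f k ^ 2) l]
        simp_rw [this]
        rw [lintegral_const_mul _ hg, mul_assoc, sq]

theorem conv_comm (f g : ℝ → ℝ≥0∞) (k : ℝ) :
    ∫⁻ l, f (k - l) * g l = ∫⁻ l, g (k - l) * f l := by
  rw [← lintegral_sub_left_eq_self _ k]
  simp [mul_comm]

theorem lintegral_one_add_sq_rpow_neg_lt_top {m : ℝ} (hm : 1 / 2 < m) :
    ∫⁻ k : ℝ, ENNReal.ofReal ((1 + k ^ 2) ^ (-m)) < ∞ := by
  have h := integrable_rpow_neg_one_add_norm_sq (E := ℝ) (μ := volume) (r := 2 * m)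
    (by simp; linarith)
  have h' : Integrable (fun k : ℝ => (1 + k ^ 2) ^ (-m)) := by
    refine h.congr (Filter.Eventually.of_forall fun k => ?_)
    simp only [Real.norm_eq_abs, sq_abs]
    congr 1
    ring
  exact h'.lintegral_lt_top

/-- The square root of the Gevrey weight. -/
noncomputable def gevreySymbol (m σ k : ℝ) : ℝ :=
  Real.exp (σ * (1 + |k|)) * (1 + k ^ 2) ^ (m / 2)

theorem gevreySymbol_nonneg (m σ k : ℝ) : 0 ≤ gevreySymbol m σ k := by
  unfold gevreySymbol; positivity

theorem gevreySymbol_sq (m σ k : ℝ) : gevreySymbol m σ k ^ 2 = gevreyWeight m σ k := by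
  rw [gevreySymbol, gevreyWeight, mul_pow, ← Real.exp_nat_mul,
    ← Real.rpow_mul_natCast (by positivity)]
  congr 2 <;> push_cast <;> ring

theorem ofReal_gevreySymbol_sq (m σ k : ℝ) :
    ENNReal.ofReal (gevreySymbol m σ k) ^ 2 = ENNReal.ofReal (gevreyWeight m σ k) := by
  rw [← ENNReal.ofReal_pow (gevreySymbol_nonneg m σ k), gevreySymbol_sq]

@[fun_prop]
theorem measurable_gevreySymbol (m σ : ℝ) : Measurable (gevreySymbol m σ) := by
  unfold gevreySymbol; fun_prop

theorem one_add_sq_rpow_le {s : ℝ} (hs : 0 ≤ s) (a b : ℝ) :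
    (1 + (a + b) ^ 2) ^ s ≤ 4 ^ s * ((1 + a ^ 2) ^ s + (1 + b ^ 2) ^ s) := by
  have key (x y : ℝ) (h : x ^ 2 ≤ y ^ 2) :
      (1 + (x + y) ^ 2) ^ s ≤ 4 ^ s * (1 + y ^ 2) ^ s := by
    rw [← Real.mul_rpow (by norm_num) (by positivity)]
    refine Real.rpow_le_rpow (by positivity) ?_ hs
    nlinarith [sq_nonneg (x - y)]
  have ha : 0 ≤ (1 + a ^ 2) ^ s := by positivity
  have hb : 0 ≤ (1 + b ^ 2) ^ s := by positivity
  have h4 : (0 : ℝ) ≤ 4 ^ s := by positivity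
  rcases le_total (a ^ 2) (b ^ 2) with h | h
  · exact (key a b h).trans (by gcongr; linarith)
  · rw [add_comm a b]
    exact (key b a h).trans (by gcongr; linarith)

theorem gevreySymbol_le {m σ : ℝ} (hm : 0 ≤ m) (hσ : 0 ≤ σ) (k l : ℝ) :
    gevreySymbol m σ k ≤ 4 ^ (m / 2) *
      (gevreySymbol m σ (k - l) * gevreySymbol 0 σ l +
        gevreySymbol 0 σ (k - l) * gevreySymbol m σ l) := by
  have h₁ : Real.exp (σ * (1 + |k|)) ≤
      Real.exp (σ * (1 + |k - l|)) * Real.exp (σ * (1 + |l|)) := by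
    rw [← Real.exp_add, Real.exp_le_exp, ← mul_add]
    refine mul_le_mul_of_nonneg_left ?_ hσ
    have := abs_add_le (k - l) l
    rw [sub_add_cancel] at this
    linarith
  have h₂ := one_add_sq_rpow_le (s := m / 2) (by positivity) (k - l) l
  rw [sub_add_cancel] at h₂
  simp only [gevreySymbol, zero_div, Real.rpow_zero, mul_one]
  refine (mul_le_mul h₁ h₂ (by positivity) (by positivity)).trans_eq ?_
  ring

theorem ofReal_gevreySymbol_le {m σ : ℝ} (hm : 0 ≤ m) (hσ : 0 ≤ σ) (k l : ℝ) :
    ENNReal.ofReal (gevreySymbol m σ k) ≤ ENNReal.ofReal (4 ^ (m / 2)) *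
      (ENNReal.ofReal (gevreySymbol m σ (k - l)) * ENNReal.ofReal (gevreySymbol 0 σ l) +
        ENNReal.ofReal (gevreySymbol 0 σ (k - l)) * ENNReal.ofReal (gevreySymbol m σ l)) := by
  have h₁ := gevreySymbol_nonneg m σ
  have h₀ := gevreySymbol_nonneg 0 σ
  rw [← ENNReal.ofReal_mul (h₁ _), ← ENNReal.ofReal_mul (h₀ _),
    ← ENNReal.ofReal_add (mul_nonneg (h₁ _) (h₀ _)) (mul_nonneg (h₀ _) (h₁ _)),
    ← ENNReal.ofReal_mul (by positivity)]
  exact ENNReal.ofReal_le_ofReal (gevreySymbol_le hm hσ k l)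

/-- The squared weighted `L²` norm of a nonnegative function of frequency. -/
noncomputable def gevreyEnergy (m σ : ℝ) (f : ℝ → ℝ≥0∞) : ℝ≥0∞ :=
  ∫⁻ k, (ENNReal.ofReal (gevreySymbol m σ k) * f k) ^ 2

theorem sq_lintegral_symbol_le (m σ : ℝ) {f : ℝ → ℝ≥0∞} (hf : Measurable f) :
    (∫⁻ k, ENNReal.ofReal (gevreySymbol 0 σ k) * f k) ^ 2 ≤
      (∫⁻ k : ℝ, ENNReal.ofReal ((1 + k ^ 2) ^ (-m))) * gevreyEnergy m σ f := by
  have h := sq_lintegral_mul_le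
    (f := fun k : ℝ => ENNReal.ofReal ((1 + k ^ 2) ^ (-m / 2)))
    (g := fun k => ENNReal.ofReal (gevreySymbol m σ k) * f k) (by fun_prop) (by fun_prop)
  have e₁ (k : ℝ) : ENNReal.ofReal ((1 + k ^ 2) ^ (-m / 2)) *
      (ENNReal.ofReal (gevreySymbol m σ k) * f k) =
      ENNReal.ofReal (gevreySymbol 0 σ k) * f k := by
    rw [← mul_assoc, ← ENNReal.ofReal_mul (by positivity), gevreySymbol, gevreySymbol,
      mul_left_comm, ← Real.rpow_add (by positivity)]
    congr 4
    ring
  have e₂ (k : ℝ) : ENNReal.ofReal ((1 + k ^ 2) ^ (-m / 2)) ^ 2 =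
      ENNReal.ofReal ((1 + k ^ 2) ^ (-m)) := by
    rw [← ENNReal.ofReal_pow (by positivity), ← Real.rpow_mul_natCast (by positivity)]
    congr 2
    push_cast
    ring
  simpa only [e₁, e₂, gevreyEnergy] using h

theorem gevreyEnergy_conv_le {m₁ m₂ σ : ℝ} (hm₁ : 0 ≤ m₁) (hσ : 0 ≤ σ) {f g h : ℝ → ℝ≥0∞}
    (hf : Measurable f) (hg : Measurable g) (hh : ∀ k, h k ≤ ∫⁻ l, f (k - l) * g l) :
    gevreyEnergy m₁ σ h ≤
      2 * ENNReal.ofReal (4 ^ (m₁ / 2)) ^ 2 *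
        (∫⁻ k : ℝ, ENNReal.ofReal ((1 + k ^ 2) ^ (-m₂))) *
        (gevreyEnergy m₁ σ f * gevreyEnergy m₂ σ g +
          gevreyEnergy m₂ σ f * gevreyEnergy m₁ σ g) := by
  set c := ENNReal.ofReal (4 ^ (m₁ / 2))
  set K := ∫⁻ k : ℝ, ENNReal.ofReal ((1 + k ^ 2) ^ (-m₂))
  set p : ℝ → ℝ≥0∞ := fun k => ENNReal.ofReal (gevreySymbol m₁ σ k) with hp
  set e : ℝ → ℝ≥0∞ := fun k => ENNReal.ofReal (gevreySymbol 0 σ k) with he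
  have hpm : Measurable p := by fun_prop
  have hem : Measurable e := by fun_prop
  set X : ℝ → ℝ≥0∞ := fun k => ∫⁻ l, (p (k - l) * f (k - l)) * (e l * g l) with hX
  set Y : ℝ → ℝ≥0∞ := fun k => ∫⁻ l, (e (k - l) * f (k - l)) * (p l * g l) with hY
  have hXm : Measurable X := by fun_prop
  have hYm : Measurable Y := by fun_prop
  have hpt (k : ℝ) : p k * h k ≤ c * (X k + Y k) := by
    calc p k * h k ≤ p k * ∫⁻ l, f (k - l) * g l := by gcongr; exact hh k
      _ = ∫⁻ l, p k * (f (k - l) * g l) := (lintegral_const_mul _ (by fun_prop)).symm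
      _ ≤ ∫⁻ l, c * ((p (k - l) * f (k - l)) * (e l * g l) +
            (e (k - l) * f (k - l)) * (p l * g l)) := by
          refine lintegral_mono fun l => ?_
          refine (mul_le_mul_left (ofReal_gevreySymbol_le hm₁ hσ k l) _).trans_eq ?_
          simp only [hp, he, c]
          ring
      _ = c * (X k + Y k) := by
          rw [lintegral_const_mul _ (by fun_prop), lintegral_add_left (by fun_prop)]
  have hsq (k : ℝ) : (p k * h k) ^ 2 ≤ 2 * c ^ 2 * (X k ^ 2 + Y k ^ 2) := by
    refine (pow_le_pow_left' (hpt k) 2).trans ?_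
    rw [mul_pow, mul_comm 2, mul_assoc]
    gcongr
    have := ENNReal.rpow_add_le_mul_rpow_add_rpow (X k) (Y k) one_le_two
    norm_num at this
    exact this
  have hXb : ∫⁻ k, X k ^ 2 ≤ gevreyEnergy m₁ σ f * (K * gevreyEnergy m₂ σ g) :=
    (lintegral_sq_conv_le (hpm.mul hf) (hem.mul hg)).trans
      (mul_le_mul_right (sq_lintegral_symbol_le m₂ σ hg) _)
  have hYb : ∫⁻ k, Y k ^ 2 ≤ gevreyEnergy m₁ σ g * (K * gevreyEnergy m₂ σ f) := by
    have (k : ℝ) : Y k = ∫⁻ l, (p * g) (k - l) * (e * f) l := conv_comm (e * f) (p * g) k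
    simp_rw [this]
    exact (lintegral_sq_conv_le (hpm.mul hg) (hem.mul hf)).trans
      (mul_le_mul_right (sq_lintegral_symbol_le m₂ σ hf) _)
  calc gevreyEnergy m₁ σ h ≤ ∫⁻ k, 2 * c ^ 2 * (X k ^ 2 + Y k ^ 2) := lintegral_mono hsq
    _ = 2 * c ^ 2 * ((∫⁻ k, X k ^ 2) + ∫⁻ k, Y k ^ 2) := by
        rw [lintegral_const_mul _ (by fun_prop), lintegral_add_left (by fun_prop)]
    _ ≤ 2 * c ^ 2 * (gevreyEnergy m₁ σ f * (K * gevreyEnergy m₂ σ g) +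
          gevreyEnergy m₁ σ g * (K * gevreyEnergy m₂ σ f)) := by gcongr
    _ = _ := by ring

theorem gevreyWeight_mul_sq_nonneg (m σ : ℝ) (u : ℝ → ℂ) (k : ℝ) :
    0 ≤ gevreyWeight m σ k * ‖fHat u k‖ ^ 2 := by
  rw [← gevreySymbol_sq]; positivity

theorem gevreyEnergy_fHat (m σ : ℝ) (u : ℝ → ℂ) :
    gevreyEnergy m σ (fun k => ‖fHat u k‖ₑ) =
      ∫⁻ k, ENNReal.ofReal (gevreyWeight m σ k * ‖fHat u k‖ ^ 2) := by
  refine lintegral_congr fun k => ?_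
  rw [← gevreySymbol_sq, ← mul_pow, ENNReal.ofReal_pow
    (mul_nonneg (gevreySymbol_nonneg m σ k) (norm_nonneg _)),
    ENNReal.ofReal_mul (gevreySymbol_nonneg m σ k), ofReal_norm]

theorem measurable_gevreyWeight_mul_sq (m σ : ℝ) {u : ℝ → ℂ} (hu : Integrable u) :
    Measurable fun k => gevreyWeight m σ k * ‖fHat u k‖ ^ 2 := by
  have := (continuous_fHat hu).measurable
  simp_rw [← gevreySymbol_sq]
  fun_prop

theorem memGevrey_iff_energy_lt_top {m σ : ℝ} {u : ℝ → ℂ} (hu : Integrable u) :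
    MemGevrey m σ u ↔ gevreyEnergy m σ (fun k => ‖fHat u k‖ₑ) < ∞ := by
  rw [gevreyEnergy_fHat, MemGevrey, and_iff_right hu, lt_top_iff_ne_top]
  exact (lintegral_ofReal_ne_top_iff_integrable
    (measurable_gevreyWeight_mul_sq m σ hu).aestronglyMeasurable
    (Filter.Eventually.of_forall (gevreyWeight_mul_sq_nonneg m σ u))).symm

theorem gevreyNorm_eq_sqrt_energy {m σ : ℝ} {u : ℝ → ℂ} (hu : Integrable u) :
    gevreyNorm m σ u = Real.sqrt (gevreyEnergy m σ fun k => ‖fHat u k‖ₑ).toReal := by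
  rw [gevreyNorm, gevreyEnergy_fHat, integral_eq_lintegral_of_nonneg_ae
    (Filter.Eventually.of_forall (gevreyWeight_mul_sq_nonneg m σ u))
    (measurable_gevreyWeight_mul_sq m σ hu).aestronglyMeasurable]

theorem MemGevrey.integrable_fHat {m σ : ℝ} (hm : 1 / 2 < m) (hσ : 0 ≤ σ) {u : ℝ → ℂ}
    (hu : MemGevrey m σ u) : Integrable (fHat u) := by
  have hc := continuous_fHat hu.1
  refine ⟨hc.aestronglyMeasurable, ?_⟩
  have h := (sq_lintegral_symbol_le m σ hc.measurable.enorm).trans_lt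
    (ENNReal.mul_lt_top (lintegral_one_add_sq_rpow_neg_lt_top hm)
      ((memGevrey_iff_energy_lt_top hu.1).1 hu))
  refine (lintegral_mono fun k => ?_).trans_lt
    ((ENNReal.pow_lt_top_iff.1 h).resolve_right two_ne_zero)
  refine le_mul_of_one_le_left' (ENNReal.one_le_ofReal.2 ?_)
  simp only [gevreySymbol, zero_div, Real.rpow_zero, mul_one]
  exact Real.one_le_exp (by positivity)

theorem sqrt_add_le_add_sqrt {x y : ℝ} (hx : 0 ≤ x) (hy : 0 ≤ y) :
    Real.sqrt (x + y) ≤ Real.sqrt x + Real.sqrt y := by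
  refine Real.sqrt_le_iff.2 ⟨by positivity, ?_⟩
  have : 0 ≤ Real.sqrt x * Real.sqrt y := by positivity
  nlinarith [Real.sq_sqrt hx, Real.sq_sqrt hy]

/-- Refined product estimate in Gevrey spaces: for `m₁, m₂ > 1/2` there is a
constant, independent of `σ ≥ 0`, with
`‖uv‖_{G^{m₁}_σ} ≤ C (‖u‖_{G^{m₁}_σ}‖v‖_{G^{m₂}_σ} + ‖u‖_{G^{m₂}_σ}‖v‖_{G^{m₁}_σ})`. -/
theorem gevrey_product_refined (m₁ m₂ : ℝ) (hm₁ : 1 / 2 < m₁) (hm₂ : 1 / 2 < m₂) :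
    ∃ C : ℝ, 0 < C ∧
      ∀ σ : ℝ, 0 ≤ σ → ∀ u v : ℝ → ℂ,
        MemGevrey m₁ σ u → MemGevrey m₂ σ u → MemGevrey m₁ σ v → MemGevrey m₂ σ v →
        MemGevrey m₁ σ (fun x => u x * v x) ∧
        gevreyNorm m₁ σ (fun x => u x * v x) ≤
          C * (gevreyNorm m₁ σ u * gevreyNorm m₂ σ v +
               gevreyNorm m₂ σ u * gevreyNorm m₁ σ v) := by
  let D : ℝ≥0∞ := 2 * ENNReal.ofReal (4 ^ (m₁ / 2)) ^ 2 *
    ∫⁻ k : ℝ, ENNReal.ofReal ((1 + k ^ 2) ^ (-m₂))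
  have hD : D < ∞ := ENNReal.mul_lt_top
    (ENNReal.mul_lt_top ENNReal.ofNat_lt_top (ENNReal.pow_lt_top ENNReal.ofReal_lt_top))
    (lintegral_one_add_sq_rpow_neg_lt_top hm₂)
  refine ⟨Real.sqrt D.toReal + 1, by positivity, fun σ hσ u v hu₁ hu₂ hv₁ hv₂ => ?_⟩
  have hu' := hu₁.integrable_fHat hm₁ hσ
  have huv := integrable_mul_of_integrable_fourier hu₁.1
    (integrable_fourier_of_integrable_fHat hu') hv₁.1
  have key : _ ≤ D * _ := gevreyEnergy_conv_le (m₁ := m₁) (m₂ := m₂) (by linarith) hσ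
    (continuous_fHat hu₁.1).measurable.enorm (continuous_fHat hv₁.1).measurable.enorm
    (enorm_fHat_mul_le hu₁.1 hu' hv₁.1)
  clear_value D
  have fu₁ := (memGevrey_iff_energy_lt_top hu₁.1).1 hu₁
  have fu₂ := (memGevrey_iff_energy_lt_top hu₁.1).1 hu₂
  have fv₁ := (memGevrey_iff_energy_lt_top hv₁.1).1 hv₁
  have fv₂ := (memGevrey_iff_energy_lt_top hv₁.1).1 hv₂
  have f₁₂ := ENNReal.mul_lt_top fu₁ fv₂
  have f₂₁ := ENNReal.mul_lt_top fu₂ fv₁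
  have hfin := ENNReal.mul_lt_top hD (ENNReal.add_lt_top.2 ⟨f₁₂, f₂₁⟩)
  refine ⟨(memGevrey_iff_energy_lt_top huv).2 (key.trans_lt hfin), ?_⟩
  have hreal := ENNReal.toReal_mono hfin.ne key
  rw [ENNReal.toReal_mul, ENNReal.toReal_add f₁₂.ne f₂₁.ne, ENNReal.toReal_mul,
    ENNReal.toReal_mul] at hreal
  rw [gevreyNorm_eq_sqrt_energy huv, gevreyNorm_eq_sqrt_energy hu₁.1,
    gevreyNorm_eq_sqrt_energy hu₁.1, gevreyNorm_eq_sqrt_energy hv₁.1,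
    gevreyNorm_eq_sqrt_energy hv₁.1, ← Real.sqrt_mul ENNReal.toReal_nonneg,
    ← Real.sqrt_mul ENNReal.toReal_nonneg]
  refine (Real.sqrt_le_sqrt hreal).trans ?_
  rw [Real.sqrt_mul (x := D.toReal) ENNReal.toReal_nonneg]
  exact mul_le_mul (by linarith) (sqrt_add_le_add_sqrt (by positivity) (by positivity))
    (by positivity) (by positivity)
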